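/- Let f be a loopless polymatroid rank function on a finite set E, let Ẽ be a finite set and π : Ẽ → E a surjection with |π⁻¹(i)| = f({i}) for every i ∈ E, and let M be the matroid on Ẽ (with ground set all of Ẽ) whose rank function is the lifted rank function rk_M(S) = min over A ⊆ E of ( f(A) + |S ∖ π⁻¹(A)| ). Let F be a proper flat of f (a flat with F ≠ E) and S ⊆ Ẽ. Then the following are equivalent: (1) for every nonempty T ⊆ S ∖ π⁻¹(F), the closure cl_M(π⁻¹(F) ∪ T) is not geometric (i.e. is not a union of fibers of π); (2) for every nonempty T ⊆ S ∖ π⁻¹(F), f(F ∪ π(T)) > f(F) + |T|. -/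

import Mathlib

/-- The lifted rank function of a polymatroid rank function `f` along a map `π`:
`g(S) = min over A ⊆ E of (f(A) + |S \ π⁻¹(A)|)`. -/
def liftRank {Et E : Type*} [Fintype Et] [Fintype E] [DecidableEq E] [DecidableEq Et]
    (π : Et → E) (f : Finset E → ℕ) (S : Finset Et) : ℕ :=
  Finset.univ.inf' Finset.univ_nonempty
    (fun A : Finset E => f A + (S.filter (fun x => π x ∉ A)).card)

/-- The (ℕ-valued) rank of a set in a matroid on a finite type:
the largest cardinality of an independent subset. -/
noncomputable def matRk {Et : Type*} [Fintype Et] (M : Matroid Et) (S : Set Et) : ℕ :=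
  sSup {n : ℕ | ∃ I : Set Et, I ⊆ S ∧ M.Indep I ∧ I.ncard = n}

/-- On a finite type, `matRk` agrees with the extended rank of the matroid. -/
lemma coe_matRk {Et : Type*} [Fintype Et] (M : Matroid Et) (X : Set Et) :
    (matRk M X : ℕ∞) = M.eRk X := by
  obtain ⟨I, hI⟩ := M.exists_isBasis' X
  have h : IsGreatest {n : ℕ | ∃ J : Set Et, J ⊆ X ∧ M.Indep J ∧ J.ncard = n} I.ncard := by
    refine ⟨⟨I, hI.subset, hI.indep, rfl⟩, ?_⟩
    rintro n ⟨J, hJX, hJ, rfl⟩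
    have := hJ.encard_le_eRk_of_subset hJX
    rw [← hI.encard_eq_eRk, ← J.toFinite.cast_ncard_eq, ← I.toFinite.cast_ncard_eq] at this
    exact_mod_cast this
  rw [matRk, h.csSup_eq, I.toFinite.cast_ncard_eq, hI.encard_eq_eRk]

/-- Nested subsets of a finite matroid with the same rank have the same closure. -/
lemma closure_eq_of_matRk_le {Et : Type*} [Fintype Et] (M : Matroid Et) {X Y : Set Et}
    (hXY : X ⊆ Y) (h : matRk M Y ≤ matRk M X) : M.closure X = M.closure Y := by
  refine (M.isRkFinite_of_finite X.toFinite).closure_eq_closure_of_subset_of_eRk_ge_eRk hXY ?_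
  rw [← coe_matRk, ← coe_matRk]
  exact_mod_cast h

lemma matRk_closure {Et : Type*} [Fintype Et] (M : Matroid Et) (X : Set Et) :
    matRk M (M.closure X) = matRk M X := by
  have := M.eRk_closure_eq X
  rw [← coe_matRk, ← coe_matRk] at this
  exact_mod_cast this

section Lift

variable {Et E : Type*} [Fintype Et] [Fintype E] [DecidableEq E] [DecidableEq Et]
  {π : Et → E} {f : Finset E → ℕ}

lemma liftRank_le (S : Finset Et) (A : Finset E) :
    liftRank π f S ≤ f A + (S.filter (fun x => π x ∉ A)).card :=
  Finset.inf'_le _ (Finset.mem_univ A)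

lemma exists_liftRank_eq (π : Et → E) (f : Finset E → ℕ) (S : Finset Et) :
    ∃ A, liftRank π f S = f A + (S.filter (fun x => π x ∉ A)).card := by
  obtain ⟨A, -, hA⟩ := Finset.exists_mem_eq_inf' Finset.univ_nonempty
    (fun A : Finset E => f A + (S.filter (fun x => π x ∉ A)).card)
  exact ⟨A, hA⟩

/-- Adding a set `F` to `A` costs at most the number of points in the fibers over `F \ A`. -/
lemma rank_union_le_add_card_fibers
    (hsub : ∀ A B : Finset E, f (A ∪ B) + f (A ∩ B) ≤ f A + f B)
    (hfiber : ∀ i : E, (Finset.univ.filter (fun x => π x = i)).card = f {i})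
    (A F : Finset E) :
    f (A ∪ F) ≤ f A + (Finset.univ.filter (fun x => π x ∈ F ∧ π x ∉ A)).card := by
  induction F using Finset.induction_on with
  | empty => simp
  | insert i F hi ih =>
    by_cases hiA : i ∈ A
    · have h1 : A ∪ insert i F = A ∪ F := by grind
      have h2 : (Finset.univ.filter (fun x => π x ∈ F ∧ π x ∉ A)) ⊆
        Finset.univ.filter (fun x => π x ∈ insert i F ∧ π x ∉ A) := by grind
      have := Finset.card_le_card h2
      rw [h1]; omega
    · have h1 : A ∪ insert i F = (A ∪ F) ∪ {i} := by grind
      have h2 : Finset.univ.filter (fun x => π x ∈ insert i F ∧ π x ∉ A) =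
        Finset.univ.filter (fun x => π x ∈ F ∧ π x ∉ A) ∪
          Finset.univ.filter (fun x => π x = i) := by grind
      have h3 : Disjoint (Finset.univ.filter (fun x => π x ∈ F ∧ π x ∉ A))
          (Finset.univ.filter (fun x => π x = i)) := by
        rw [Finset.disjoint_left]; grind
      rw [h1, h2, Finset.card_union_of_disjoint h3, hfiber]
      have := hsub (A ∪ F) {i}
      omega

/-- The minimum defining the lifted rank of `π⁻¹(F) ∪ T` is attained at a set containing `F`. -/
lemma exists_rank_add_card_le_liftRank
    (hsub : ∀ A B : Finset E, f (A ∪ B) + f (A ∩ B) ≤ f A + f B)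
    (hfiber : ∀ i : E, (Finset.univ.filter (fun x => π x = i)).card = f {i})
    (F : Finset E) (T : Finset Et) (hT : ∀ t ∈ T, π t ∉ F) :
    ∃ A, F ⊆ A ∧ f A + (T.filter (fun x => π x ∉ A)).card ≤
      liftRank π f (Finset.univ.filter (fun x => π x ∈ F) ∪ T) := by
  obtain ⟨A, hA⟩ := exists_liftRank_eq π f (Finset.univ.filter (fun x => π x ∈ F) ∪ T)
  refine ⟨A ∪ F, Finset.subset_union_right, ?_⟩
  have h1 : (Finset.univ.filter (fun x => π x ∈ F) ∪ T).filter (fun x => π x ∉ A) =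
      Finset.univ.filter (fun x => π x ∈ F ∧ π x ∉ A) ∪
        T.filter (fun x => π x ∉ A ∪ F) := by
    ext x
    have := hT x
    simp only [Finset.mem_filter, Finset.mem_union, Finset.mem_univ, true_and]
    tauto
  have h2 : Disjoint (Finset.univ.filter (fun x => π x ∈ F ∧ π x ∉ A))
      (T.filter (fun x => π x ∉ A ∪ F)) := by
    rw [Finset.disjoint_left]; grind
  rw [hA, h1, Finset.card_union_of_disjoint h2]
  have := rank_union_le_add_card_fibers hsub hfiber A F
  omega

lemma liftRank_preimage
    (hsub : ∀ A B : Finset E, f (A ∪ B) + f (A ∩ B) ≤ f A + f B)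
    (hmono : ∀ A B : Finset E, A ⊆ B → f A ≤ f B)
    (hfiber : ∀ i : E, (Finset.univ.filter (fun x => π x = i)).card = f {i})
    (F : Finset E) : liftRank π f (Finset.univ.filter (fun x => π x ∈ F)) = f F := by
  apply le_antisymm
  · simpa [Finset.filter_filter] using
      liftRank_le (π := π) (f := f) (Finset.univ.filter (fun x => π x ∈ F)) F
  · obtain ⟨A, hFA, hA⟩ := exists_rank_add_card_le_liftRank hsub hfiber F ∅ (by simp)
    have := hmono _ _ hFA
    simp only [Finset.union_empty] at hA
    omega

variable {M : Matroid Et}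

lemma matRk_preimage
    (hsub : ∀ A B : Finset E, f (A ∪ B) + f (A ∩ B) ≤ f A + f B)
    (hmono : ∀ A B : Finset E, A ⊆ B → f A ≤ f B)
    (hfiber : ∀ i : E, (Finset.univ.filter (fun x => π x = i)).card = f {i})
    (hrk : ∀ S : Finset Et, matRk M ↑S = liftRank π f S) (F : Finset E) :
    matRk M (π ⁻¹' ↑F) = f F := by
  rw [← liftRank_preimage hsub hmono hfiber F, ← hrk]
  congr 1
  ext; simp

lemma matRk_preimage_union
    (hrk : ∀ S : Finset Et, matRk M ↑S = liftRank π f S) (F : Finset E) (T : Finset Et) :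
    matRk M (π ⁻¹' ↑F ∪ ↑T) =
      liftRank π f (Finset.univ.filter (fun x => π x ∈ F) ∪ T) := by
  rw [← hrk]
  congr 1
  ext; simp

/-- The closure of a geometric set in the lift is geometric. -/
lemma preimage_image_closure_preimage
    (hsub : ∀ A B : Finset E, f (A ∪ B) + f (A ∩ B) ≤ f A + f B)
    (hmono : ∀ A B : Finset E, A ⊆ B → f A ≤ f B)
    (hfiber : ∀ i : E, (Finset.univ.filter (fun x => π x = i)).card = f {i})
    (hE : M.E = Set.univ)
    (hrk : ∀ S : Finset Et, matRk M ↑S = liftRank π f S) (F : Finset E) :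
    π ⁻¹' (π '' M.closure (π ⁻¹' ↑F)) = M.closure (π ⁻¹' ↑F) := by
  refine (Set.subset_preimage_image _ _).antisymm' ?_
  rintro y ⟨x, hx, hxy⟩
  have hground (X : Set Et) : X ⊆ M.E := hE ▸ X.subset_univ
  by_cases hxF : π x ∈ F
  · exact M.subset_closure _ (hground _) (by simpa [← hxy] using hxF)
  obtain ⟨A, hFA, hA⟩ :=
    exists_rank_add_card_le_liftRank hsub hfiber F {x} (by simpa using hxF)
  have hle : matRk M (π ⁻¹' ↑F ∪ ↑({x} : Finset Et)) = f F := by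
    rw [← matRk_closure, ← matRk_preimage hsub hmono hfiber hrk F, ← matRk_closure M (π ⁻¹' _)]
    congr 1
    rw [Finset.coe_singleton, Set.union_singleton, Matroid.closure_insert_eq_of_mem_closure hx]
  rw [← matRk_preimage_union hrk, hle] at hA
  have hFA' := hmono _ _ hFA
  have hcard : (Finset.filter (fun x => π x ∉ A) {x}).card = 0 := by omega
  have hxA : π x ∈ A := by
    by_contra h
    simp [Finset.filter_singleton, h] at hcard
  have hcl : M.closure (π ⁻¹' ↑F) = M.closure (π ⁻¹' ↑A) := by
    refine closure_eq_of_matRk_le M (Set.preimage_mono (by exact_mod_cast hFA)) ?_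
    rw [matRk_preimage hsub hmono hfiber hrk, matRk_preimage hsub hmono hfiber hrk]
    omega
  rw [hcl]
  exact M.subset_closure _ (hground _) (by simpa [← hxy] using hxA)

end Lift

/-- for a proper flat `F` of a loopless polymatroid `f` and a subset
`S ⊆ Ẽ`, the closure in the minimal lift `M` of `π⁻¹(F) ∪ T` is non-geometric for every
nonempty `T ⊆ S ∖ π⁻¹(F)` iff `f(F ∪ π(T)) > f(F) + |T|` for every such `T`. -/
theorem nonGeometric_closure_iff_rank_inequality {Et E : Type*} [Fintype Et] [Fintype E]
    [DecidableEq E] [DecidableEq Et]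
    (π : Et → E) (hπ : Function.Surjective π) (f : Finset E → ℕ)
    (hsub : ∀ A B : Finset E, f (A ∪ B) + f (A ∩ B) ≤ f A + f B)
    (hmono : ∀ A B : Finset E, A ⊆ B → f A ≤ f B)
    (hnorm : f ∅ = 0)
    (hloopless : ∀ A : Finset E, A.Nonempty → 0 < f A)
    (hfiber : ∀ i : E, (Finset.univ.filter (fun x => π x = i)).card = f {i})
    (M : Matroid Et) (hE : M.E = Set.univ)
    (hrk : ∀ S : Finset Et, matRk M ↑S = liftRank π f S)
    (F : Finset E) (hflat : ∀ i ∉ F, f F < f (insert i F)) (hproper : F ≠ Finset.univ)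
    (S : Finset Et) :
    (∀ T : Finset Et, T.Nonempty → T ⊆ S → (∀ t ∈ T, π t ∉ F) →
        ¬ (M.closure (π ⁻¹' ↑F ∪ ↑T)
            = π ⁻¹' (π '' M.closure (π ⁻¹' ↑F ∪ ↑T)))) ↔
    (∀ T : Finset Et, T.Nonempty → T ⊆ S → (∀ t ∈ T, π t ∉ F) →
        f F + T.card < f (F ∪ T.image π)) := by
  constructor
  · intro h T
    induction T using Finset.strongInduction with
    | H T ih =>
      intro hT hTS hTF
      by_contra! hle
      apply h T hT hTS hTF
      have hcl : M.closure (π ⁻¹' ↑F ∪ ↑T) = M.closure (π ⁻¹' ↑(F ∪ T.image π)) := by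
        apply closure_eq_of_matRk_le
        · apply Set.union_subset
          · exact Set.preimage_mono (by simp)
          · intro t ht
            simpa using Or.inr ⟨t, ht, rfl⟩
        rw [matRk_preimage hsub hmono hfiber hrk, matRk_preimage_union hrk]
        obtain ⟨A, hFA, hA⟩ := exists_rank_add_card_le_liftRank hsub hfiber F T hTF
        refine le_trans ?_ hA
        have hsplit := T.card_filter_add_card_filter_not (fun x => π x ∈ A)
        have hsubT : T.filter (fun x => π x ∈ A) ⊆ T := Finset.filter_subset _ _
        have hFA' : F ∪ (T.filter (fun x => π x ∈ A)).image π ⊆ A :=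
          Finset.union_subset hFA (Finset.image_subset_iff.2 fun x hx => (Finset.mem_filter.1 hx).2)
        have hrank := hmono _ _ hFA'
        rcases hsubT.eq_or_ssubset with heq | hss
        · rw [heq] at hrank
          omega
        rcases (T.filter (fun x => π x ∈ A)).eq_empty_or_nonempty with hemp | hne
        · have := hmono _ _ hFA
          rw [hemp, Finset.card_empty] at hsplit
          omega
        · have := ih _ hss hne (hsubT.trans hTS) fun t ht => hTF t (hsubT ht)
          omega
      rw [hcl, preimage_image_closure_preimage hsub hmono hfiber hE hrk]
  · intro h T hT hTS hTF hgeo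
    have hlt := h T hT hTS hTF
    have hsubcl : π ⁻¹' ↑(F ∪ T.image π) ⊆ M.closure (π ⁻¹' ↑F ∪ ↑T) := by
      have hX := M.subset_closure (π ⁻¹' ↑F ∪ ↑T) (hE ▸ Set.subset_univ _)
      intro x hx
      simp only [Finset.coe_union, Finset.coe_image, Set.mem_preimage, Set.mem_union] at hx
      rcases hx with hx | ⟨t, ht, hxt⟩
      · exact hX (Or.inl hx)
      · rw [hgeo]
        exact ⟨t, hX (Or.inr ht), hxt⟩
    have hrank := M.eRk_mono hsubcl
    rw [Matroid.eRk_closure_eq, ← coe_matRk, ← coe_matRk,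
      matRk_preimage hsub hmono hfiber hrk, matRk_preimage_union hrk, Nat.cast_le] at hrank
    have hle := liftRank_le (π := π) (f := f) (Finset.univ.filter (fun x => π x ∈ F) ∪ T) F
    have hT' : (Finset.univ.filter (fun x => π x ∈ F) ∪ T).filter (fun x => π x ∉ F) ⊆ T := by
      grind
    have := Finset.card_le_card hT'
    omega
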